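/- Let F = ℚ(q,d₄,Λ,x) be the field of rational functions over ℚ in the indeterminates q, d₄, Λ, x. Let m, n ∈ ℕ and let k be an integer with −n ≤ k ≤ m. For m−k−n ≤ j ≤ m define r^{WV}_{k,j} := q^{(j−k−m−n−1)(j+k−m+n)/2} (−Λ)^{j+k−m+n} · (q;q)_{k+n}/((q;q)_{k+j−m+n}(q;q)_{m−j}) · (q^{m+1}/(d₄Λ);q)_{k+j−m+n} (q^{j+1}/d₄;q)_{m−j} / (q^{−k−n}Λ;q)_{k+n}. Then (−q x/(Λ d₄);q)_{k+n} = Σ_{j=m−k−n}^{m} r^{WV}_{k,j} · (−q^{−m} x;q)_{m−j} · (−q^{1−j} x/Λ;q)_{j+n−m+k}. -/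

import Mathlib

open Finset

/-- The `q`-shifted factorial `(a;q)_n = ∏_{i=0}^{n-1} (1 - a q^i)`. -/
noncomputable def qPoch {F : Type*} [Field F] (q a : F) (n : ℕ) : F :=
  ∏ i ∈ Finset.range n, (1 - a * q ^ i)

/-- The field `F = ℚ(q,d₄,Λ,x)` of rational functions over `ℚ` in four indeterminates. -/
noncomputable abbrev F2 : Type := FractionRing (MvPolynomial (Fin 4) ℚ)

section Saalschutz

variable {F : Type*} [Field F]

theorem qPoch_zero (q a : F) : qPoch q a 0 = 1 := by simp [qPoch]

theorem qPoch_succ (q a : F) (n : ℕ) :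
    qPoch q a (n + 1) = qPoch q a n * (1 - a * q ^ n) := by
  simp [qPoch, Finset.prod_range_succ]

theorem qPoch_succ' (q a : F) (n : ℕ) :
    qPoch q a (n + 1) = (1 - a) * qPoch q (a * q) n := by
  simp only [qPoch, Finset.prod_range_succ', pow_zero, mul_one]
  rw [mul_comm]
  congr 1
  exact Finset.prod_congr rfl fun i _ => by ring

theorem qPoch_ne_zero {q a : F} (h : ∀ i, a * q ^ i ≠ 1) (n : ℕ) : qPoch q a n ≠ 0 :=
  Finset.prod_ne_zero_iff.2 fun i _ => sub_ne_zero.2 (h i).symm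

theorem qPoch_self_ne_zero {q : F} (h : ∀ i : ℕ, q ^ (i + 1) ≠ 1) (n : ℕ) :
    qPoch q q n ≠ 0 :=
  qPoch_ne_zero (fun i => by rw [← pow_succ']; exact h i) n

/-- The product `∏_{i=1}^{s} (c - q^i)`. -/
noncomputable def shiftedProd (q c : F) (s : ℕ) : F :=
  ∏ i ∈ Finset.range s, (c - q ^ (i + 1))

theorem shiftedProd_succ (q c : F) (s : ℕ) :
    shiftedProd q c (s + 1) = shiftedProd q c s * (c - q ^ (s + 1)) := by
  simp [shiftedProd, Finset.prod_range_succ]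

/-- The summand of the polynomial form of the `q`-Pfaff–Saalschütz sum. -/
noncomputable def saalTerm (q y z c : F) (N s : ℕ) : F :=
  qPoch q q N / (qPoch q q s * qPoch q q (N - s)) *
    (z ^ s * shiftedProd q c s * qPoch q y s *
      qPoch q (c * z) (N - s) * qPoch q (y * z * q ^ (s + 1)) (N - s))

/-- The telescoping certificate for `saalTerm`. -/
noncomputable def saalCert (q y z c : F) (N s : ℕ) : F :=
  q ^ (N - s) * (qPoch q q N / (qPoch q q s * qPoch q q (N - s))) *
    (z ^ (s + 1) * shiftedProd q c (s + 1) * qPoch q y (s + 1) *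
      qPoch q (c * z) (N - s) * qPoch q (y * z * q ^ (s + 1)) (N - s))

theorem saalTerm_zero_step (q y z c : F) (h : ∀ i : ℕ, q ^ (i + 1) ≠ 1) (N : ℕ) :
    saalTerm q y z c (N + 1) 0 =
      (1 - y * z * c * q ^ N) * (1 - z * q ^ (N + 1)) * saalTerm q y z c N 0
        - saalCert q y z c N 0 := by
  have h1 := qPoch_self_ne_zero h N
  have h2 := qPoch_self_ne_zero h (N + 1)
  simp only [saalTerm, saalCert, Nat.sub_zero, qPoch_zero, one_mul, div_self h1, div_self h2,
    shiftedProd_succ, qPoch_succ q y, qPoch_succ q (c * z), qPoch_succ q (y * z * q ^ (0 + 1))]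
  simp only [shiftedProd, Finset.prod_range_zero]
  ring

theorem saalTerm_succ_step (q y z c : F) (h : ∀ i : ℕ, q ^ (i + 1) ≠ 1) (s d : ℕ) :
    saalTerm q y z c (s + 1 + d + 1) (s + 1) =
      (1 - y * z * c * q ^ (s + 1 + d)) * (1 - z * q ^ (s + 1 + d + 1)) *
          saalTerm q y z c (s + 1 + d) (s + 1)
        - saalCert q y z c (s + 1 + d) (s + 1) + saalCert q y z c (s + 1 + d) s := by
  have e1 : s + 1 + d + 1 - (s + 1) = d + 1 := by omega
  have e2 : s + 1 + d - (s + 1) = d := by omega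
  have e3 : s + 1 + d - s = d + 1 := by omega
  have h1 := qPoch_self_ne_zero h s
  have h2 := qPoch_self_ne_zero h d
  have h3 : 1 - q * q ^ s ≠ 0 := sub_ne_zero.2 (by rw [← pow_succ']; exact (h s).symm)
  have h4 : 1 - q * q ^ d ≠ 0 := sub_ne_zero.2 (by rw [← pow_succ']; exact (h d).symm)
  simp only [saalTerm, saalCert, e1, e2, e3]
  rw [qPoch_succ' q (y * z * q ^ (s + 1)),
    show y * z * q ^ (s + 1) * q = y * z * q ^ (s + 1 + 1) by ring]
  rw [shiftedProd_succ q c (s + 1), qPoch_succ q y (s + 1), qPoch_succ q (c * z) d,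
    qPoch_succ q (y * z * q ^ (s + 1 + 1)) d, qPoch_succ q q (s + 1 + d), qPoch_succ q q s,
    qPoch_succ q q d]
  generalize qPoch q (y * z * q ^ (s + 1 + 1)) d = A
  generalize qPoch q (c * z) d = B
  generalize qPoch q y (s + 1) = C
  generalize shiftedProd q c (s + 1) = D
  generalize qPoch q q (s + 1 + d) = E
  generalize qPoch q q s = G at *
  generalize qPoch q q d = H at *
  simp only [pow_add, pow_one] at *
  generalize q ^ s = S at *
  generalize q ^ d = T at *
  generalize z ^ s = Z at *
  field_simp
  ring

theorem sum_saalTerm_step (q y z c : F) (h : ∀ i : ℕ, q ^ (i + 1) ≠ 1) (N s : ℕ)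
    (hs : s ≤ N) :
    ∑ i ∈ Finset.range (s + 1), saalTerm q y z c (N + 1) i =
      (1 - y * z * c * q ^ N) * (1 - z * q ^ (N + 1)) *
          ∑ i ∈ Finset.range (s + 1), saalTerm q y z c N i
        - saalCert q y z c N s := by
  induction s with
  | zero => simpa using saalTerm_zero_step q y z c h N
  | succ s ih =>
    obtain ⟨d, rfl⟩ := Nat.exists_eq_add_of_le hs
    rw [Finset.sum_range_succ, ih (by omega), Finset.sum_range_succ _ (s + 1),
      saalTerm_succ_step q y z c h]
    ring

theorem saalTerm_last (q y z c : F) (h : ∀ i : ℕ, q ^ (i + 1) ≠ 1) (N : ℕ) :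
    saalTerm q y z c (N + 1) (N + 1) = saalCert q y z c N N := by
  simp only [saalTerm, saalCert, Nat.sub_self, qPoch_zero, mul_one, pow_zero,
    div_self (qPoch_self_ne_zero h _)]

/-- The `q`-Pfaff–Saalschütz sum in polynomial form. -/
theorem sum_saalTerm (q y z c : F) (h : ∀ i : ℕ, q ^ (i + 1) ≠ 1) (N : ℕ) :
    ∑ i ∈ Finset.range (N + 1), saalTerm q y z c N i =
      qPoch q (y * z * c) N * qPoch q (q * z) N := by
  induction N with
  | zero => simp [saalTerm, qPoch, shiftedProd]
  | succ N ih =>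
    rw [Finset.sum_range_succ, sum_saalTerm_step q y z c h N N le_rfl, saalTerm_last q y z c h,
      ih, qPoch_succ, qPoch_succ]
    ring

theorem triangle_succ (s : ℕ) : (s + 1) * (s + 1 + 1) / 2 = s * (s + 1) / 2 + (s + 1) := by
  rw [show (s + 1) * (s + 1 + 1) = s * (s + 1) + (s + 1) * 2 by ring,
    Nat.add_mul_div_right _ _ two_pos]

theorem qPoch_zpow_neg_mul {q : F} (hq : q ≠ 0) (c : F) (s : ℕ) :
    q ^ (s * (s + 1) / 2) * qPoch q (c * q ^ (-(s : ℤ))) s = (-1) ^ s * shiftedProd q c s := by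
  induction s with
  | zero => simp [qPoch, shiftedProd]
  | succ s ih =>
    have e : c * q ^ (-((s + 1 : ℕ) : ℤ)) * q = c * q ^ (-(s : ℤ)) := by
      rw [mul_assoc, ← zpow_add_one₀ hq]
      congr 2
      push_cast
      ring
    rw [qPoch_succ', e, shiftedProd_succ, triangle_succ, pow_add,
      show ∀ a b u v : F, a * b * (u * v) = a * v * (b * u) by intros; ring, ih,
      zpow_neg, zpow_natCast]
    field_simp
    ring

theorem shiftedProd_eq_qPoch_inv {a : F} (q : F) (ha : a ≠ 0) (s : ℕ) :
    shiftedProd q a s = a ^ s * qPoch q (q * a⁻¹) s := by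
  induction s with
  | zero => simp [qPoch, shiftedProd]
  | succ s ih =>
    rw [shiftedProd_succ, qPoch_succ, ih]
    field_simp
    ring

theorem triangle_add_sub (s t : ℕ) :
    (-(s : ℤ) - (s + t : ℕ) - 1) * (t : ℤ) / 2 =
      (s * (s + 1) / 2 : ℕ) - ((s + t) * (s + t + 1) / 2 : ℕ) := by
  have h1 : 2 * (s * (s + 1) / 2) = s * (s + 1) :=
    Nat.mul_div_cancel' (Nat.even_mul_succ_self s).two_dvd
  have h2 : 2 * ((s + t) * (s + t + 1) / 2) = (s + t) * (s + t + 1) :=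
    Nat.mul_div_cancel' (Nat.even_mul_succ_self (s + t)).two_dvd
  generalize s * (s + 1) / 2 = A at *
  generalize (s + t) * (s + t + 1) / 2 = B at *
  apply Int.ediv_eq_of_eq_mul_left two_ne_zero
  zify at h1 h2
  push_cast
  linear_combination h2 - h1

theorem transition_term_eq {q d L x : F} (hq : q ≠ 0) (hd : d ≠ 0) (hL : L ≠ 0)
    (h : ∀ i : ℕ, q ^ (i + 1) ≠ 1) (hqL : ∀ i : ℕ, q ^ (i + 1) ≠ L) (m s t : ℕ) :
    (q ^ ((-(s : ℤ) - (s + t : ℕ) - 1) * (t : ℤ) / 2) * (-L) ^ t *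
        (qPoch q q (s + t) / (qPoch q q t * qPoch q q s)) *
        (qPoch q (q ^ ((m : ℤ) + 1) / (d * L)) t *
          qPoch q (q ^ ((m : ℤ) - s + 1) / d) s /
          qPoch q (q ^ (-((s + t : ℕ) : ℤ)) * L) (s + t))) *
      qPoch q (-(q ^ (-(m : ℤ))) * x) s *
      qPoch q (-(q ^ (1 - ((m : ℤ) - s))) * x / L) t =
    saalTerm q (-(q ^ (-(m : ℤ))) * x) L⁻¹ (q ^ ((m : ℤ) + 1) / d) (s + t) s /
      qPoch q (q * L⁻¹) (s + t) := by
  have hV := qPoch_zpow_neg_mul hq L (s + t)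
  rw [shiftedProd_eq_qPoch_inv q hL, mul_comm L] at hV
  have hU := qPoch_zpow_neg_mul hq (q ^ ((m : ℤ) + 1) / d) s
  have e1 : q ^ ((m : ℤ) - s + 1) / d = q ^ ((m : ℤ) + 1) / d * q ^ (-(s : ℤ)) := by
    rw [div_mul_eq_mul_div, ← zpow_add₀ hq]
    congr 2
    ring
  have e2 : -(q ^ (1 - ((m : ℤ) - s))) * x / L =
      -(q ^ (-(m : ℤ))) * x * L⁻¹ * q ^ (s + 1) := by
    rw [show 1 - ((m : ℤ) - s) = -(m : ℤ) + ((s + 1 : ℕ) : ℤ) by push_cast; ring,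
      zpow_add₀ hq, zpow_natCast]
    ring
  have e3 : q ^ ((m : ℤ) + 1) / (d * L) = q ^ ((m : ℤ) + 1) / d * L⁻¹ := by
    field_simp
  have hR : qPoch q (q * L⁻¹) (s + t) ≠ 0 := qPoch_ne_zero (fun i hi => hqL i (by
    field_simp at hi
    rw [← hi]
    ring)) _
  rw [e1, e2, e3, triangle_add_sub, zpow_sub₀ hq, zpow_natCast, zpow_natCast]
  simp only [saalTerm, Nat.add_sub_cancel_left]
  have hA : q ^ (s * (s + 1) / 2) ≠ 0 := pow_ne_zero _ hq
  have hB : q ^ ((s + t) * (s + t + 1) / 2) ≠ 0 := pow_ne_zero _ hq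
  have h1 := qPoch_self_ne_zero h s
  have h2 := qPoch_self_ne_zero h t
  have hW : qPoch q (q ^ (-((s + t : ℕ) : ℤ)) * L) (s + t) ≠ 0 := fun h0 => by
    rw [h0, mul_zero] at hV
    exact mul_ne_zero (pow_ne_zero _ (neg_ne_zero.2 one_ne_zero))
      (mul_ne_zero (pow_ne_zero _ hL) hR) hV.symm
  have hcore : q ^ (s * (s + 1) / 2) / q ^ ((s + t) * (s + t + 1) / 2) * (-L) ^ t *
      (qPoch q (q ^ ((m : ℤ) + 1) / d * q ^ (-(s : ℤ))) s /
        qPoch q (q ^ (-((s + t : ℕ) : ℤ)) * L) (s + t)) =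
      L⁻¹ ^ s * shiftedProd q (q ^ ((m : ℤ) + 1) / d) s / qPoch q (q * L⁻¹) (s + t) := by
    rw [div_mul_eq_mul_div, div_mul_div_comm, hV,
      show ∀ a b u : F, a * b * u = a * u * b by intros; ring, hU, neg_pow L, inv_pow, pow_add,
      pow_add]
    have hs : ((-1 : F)) ^ s ≠ 0 := pow_ne_zero _ (neg_ne_zero.2 one_ne_zero)
    have ht : ((-1 : F)) ^ t ≠ 0 := pow_ne_zero _ (neg_ne_zero.2 one_ne_zero)
    field_simp
  linear_combination
    (qPoch q q (s + t) / (qPoch q q t * qPoch q q s)) *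
      qPoch q (q ^ ((m : ℤ) + 1) / d * L⁻¹) t * qPoch q (-(q ^ (-(m : ℤ))) * x) s *
      qPoch q (-(q ^ (-(m : ℤ))) * x * L⁻¹ * q ^ (s + 1)) t * hcore

end Saalschutz

/-- the anti-diagonally lower-triangular transition
`(-qx/(Λd₄);q)_{k+n} = Σ_{j=m-k-n}^{m} r^{WV}_{k,j} (-q^{-m}x;q)_{m-j}
   (-q^{1-j}x/Λ;q)_{j+n-m+k}` with the factorized coefficients `r^{WV}_{k,j}`. -/
theorem statement2
    (q d₄ Λ x : F2)
    (hq : q = algebraMap (MvPolynomial (Fin 4) ℚ) F2 (MvPolynomial.X 0))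
    (hd₄ : d₄ = algebraMap (MvPolynomial (Fin 4) ℚ) F2 (MvPolynomial.X 1))
    (hΛ : Λ = algebraMap (MvPolynomial (Fin 4) ℚ) F2 (MvPolynomial.X 2))
    (hx : x = algebraMap (MvPolynomial (Fin 4) ℚ) F2 (MvPolynomial.X 3))
    (m n : ℕ) (k : ℤ) (hk₁ : -(n : ℤ) ≤ k) (hk₂ : k ≤ (m : ℤ)) :
    qPoch q (-q * x / (Λ * d₄)) (k + (n : ℤ)).toNat =
      ∑ j ∈ Finset.Icc ((m : ℤ) - k - (n : ℤ)) (m : ℤ),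
        (q ^ ((j - k - (m : ℤ) - (n : ℤ) - 1) * (j + k - (m : ℤ) + (n : ℤ)) / 2) *
            (-Λ) ^ (j + k - (m : ℤ) + (n : ℤ)).toNat *
            (qPoch q q (k + (n : ℤ)).toNat /
              (qPoch q q (k + j - (m : ℤ) + (n : ℤ)).toNat * qPoch q q ((m : ℤ) - j).toNat)) *
            (qPoch q (q ^ ((m : ℤ) + 1) / (d₄ * Λ)) (k + j - (m : ℤ) + (n : ℤ)).toNat *
              qPoch q (q ^ (j + 1) / d₄) ((m : ℤ) - j).toNat /
              qPoch q (q ^ (-k - (n : ℤ)) * Λ) (k + (n : ℤ)).toNat)) *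
          qPoch q (-(q ^ (-(m : ℤ))) * x) ((m : ℤ) - j).toNat *
          qPoch q (-(q ^ (1 - j)) * x / Λ) (j + (n : ℤ) - (m : ℤ) + k).toNat := by
  have hinj := IsFractionRing.injective (MvPolynomial (Fin 4) ℚ) F2
  have hX : ∀ i : Fin 4, algebraMap (MvPolynomial (Fin 4) ℚ) F2 (MvPolynomial.X i) ≠ 0 :=
    fun i => (map_ne_zero_iff _ hinj).2 (MvPolynomial.X_ne_zero i)
  have hq0 : q ≠ 0 := hq ▸ hX 0
  have hd0 : d₄ ≠ 0 := hd₄ ▸ hX 1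
  have hL0 : Λ ≠ 0 := hΛ ▸ hX 2
  have hq1 : ∀ i : ℕ, q ^ (i + 1) ≠ 1 := fun i hi => by
    rw [hq, ← map_pow, ← map_one (algebraMap (MvPolynomial (Fin 4) ℚ) F2)] at hi
    simpa using congrArg (MvPolynomial.eval fun _ => (0 : ℚ)) (hinj hi)
  have hqL : ∀ i : ℕ, q ^ (i + 1) ≠ Λ := fun i hi => by
    rw [hq, hΛ, ← map_pow] at hi
    simpa using congrArg (MvPolynomial.eval fun j : Fin 4 => if j = 0 then (0 : ℚ) else 1)
      (hinj hi)
  clear hq hd₄ hΛ hx hX hinj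
  obtain ⟨N, hN⟩ : ∃ N : ℕ, k + (n : ℤ) = N := ⟨(k + n).toNat, by omega⟩
  obtain rfl : k = N - n := by omega
  have hR : qPoch q (q * Λ⁻¹) N ≠ 0 := qPoch_ne_zero (fun i hi => hqL i (by
    field_simp at hi
    rw [← hi]
    ring)) _
  have hsum := sum_saalTerm q (-(q ^ (-(m : ℤ))) * x) Λ⁻¹ (q ^ ((m : ℤ) + 1) / d₄) hq1 N
  have e0 : -q * x / (Λ * d₄) =
      -(q ^ (-(m : ℤ))) * x * Λ⁻¹ * (q ^ ((m : ℤ) + 1) / d₄) := by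
    rw [zpow_add₀ hq0, zpow_neg, zpow_one]
    have : q ^ (m : ℤ) ≠ 0 := zpow_ne_zero _ hq0
    field_simp
  rw [hN, Int.toNat_natCast, e0, eq_div_of_mul_eq hR hsum.symm, Finset.sum_div]
  symm
  refine Finset.sum_bij' (fun j _ => ((m : ℤ) - j).toNat) (fun s _ => (m : ℤ) - s) ?_ ?_ ?_ ?_ ?_
  · intro j hj
    simp only [Finset.mem_Icc, Finset.mem_range] at *
    omega
  · intro s hs
    simp only [Finset.mem_Icc, Finset.mem_range] at *
    omega
  · intro j hj
    simp only [Finset.mem_Icc] at *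
    omega
  · intro s hs
    simp
  · intro j hj
    simp only [Finset.mem_Icc] at hj
    obtain ⟨s, hs⟩ : ∃ s : ℕ, (m : ℤ) - j = s := ⟨((m : ℤ) - j).toNat, by omega⟩
    obtain ⟨t, rfl⟩ : ∃ t : ℕ, N = s + t := ⟨N - s, by omega⟩
    obtain rfl : j = m - s := by omega
    have a1 : (m : ℤ) - s - (((s + t : ℕ) : ℤ) - n) - m - n - 1 = -(s : ℤ) - (s + t : ℕ) - 1 := by
      ring
    have a2 : (m : ℤ) - s + (((s + t : ℕ) : ℤ) - n) - m + n = t := by push_cast; ring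
    have a3 : ((s + t : ℕ) : ℤ) - n + (m - s) - m + n = t := by push_cast; ring
    have a4 : (m : ℤ) - s + n - m + (((s + t : ℕ) : ℤ) - n) = t := by push_cast; ring
    have a5 : -(((s + t : ℕ) : ℤ) - n) - n = -((s + t : ℕ) : ℤ) := by ring
    simp only [a1, a2, a3, a4, a5, sub_sub_cancel, Int.toNat_natCast]
    exact transition_term_eq hq0 hd0 hL0 hq1 hqL m s t
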